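/- Under the stated setup, for every agent i ∈ {1,…,m} and every k ≥ 2 one has ‖x_i^k − x_i^{k−1}‖ ≤ (5ρ̄ + 7C_p) γ_{k−1}. -/

import Mathlib

/-- The weighted combinations of a family of vectors given by the rows of a matrix. -/
def mix {m d : ℕ} (W : Matrix (Fin m) (Fin m) ℝ) (v : Fin m → EuclideanSpace ℝ (Fin d)) :
    Fin m → EuclideanSpace ℝ (Fin d) :=
  fun i => ∑ j, W i j • v j

/-- The deviations of a family of vectors from its average. -/
noncomputable def deviation {m d : ℕ} (v : Fin m → EuclideanSpace ℝ (Fin d)) :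
    Fin m → EuclideanSpace ℝ (Fin d) :=
  fun i => v i - (m : ℝ)⁻¹ • ∑ j, v j

/-- The Euclidean norm of the stacked vector of a family of vectors. -/
noncomputable def stackedNorm {m d : ℕ} (v : Fin m → EuclideanSpace ℝ (Fin d)) : ℝ :=
  ‖(WithLp.toLp 2 v : PiLp 2 fun _ : Fin m => EuclideanSpace ℝ (Fin d))‖

section Network

variable {m d : ℕ} {W : Matrix (Fin m) (Fin m) ℝ}

theorem stackedNorm_eq (v : Fin m → EuclideanSpace ℝ (Fin d)) :
    stackedNorm v = Real.sqrt (∑ i, ‖v i‖ ^ 2) := by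
  simp [stackedNorm, PiLp.norm_eq_of_L2]

theorem stackedNorm_nonneg (v : Fin m → EuclideanSpace ℝ (Fin d)) : 0 ≤ stackedNorm v :=
  norm_nonneg _

theorem norm_le_stackedNorm (v : Fin m → EuclideanSpace ℝ (Fin d)) (i : Fin m) :
    ‖v i‖ ≤ stackedNorm v :=
  PiLp.norm_apply_le (WithLp.toLp 2 v : PiLp 2 fun _ : Fin m => EuclideanSpace ℝ (Fin d)) i

theorem stackedNorm_smul_add_smul_le {a b : ℝ} (ha : 0 ≤ a) (hb : 0 ≤ b)
    (v w : Fin m → EuclideanSpace ℝ (Fin d)) :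
    stackedNorm (a • v + b • w) ≤ a * stackedNorm v + b * stackedNorm w := by
  unfold stackedNorm
  rw [WithLp.toLp_add, WithLp.toLp_smul, WithLp.toLp_smul]
  refine (norm_add_le _ _).trans_eq ?_
  rw [norm_smul, norm_smul, Real.norm_of_nonneg ha, Real.norm_of_nonneg hb]

theorem stackedNorm_le_sqrt_mul {v : Fin m → EuclideanSpace ℝ (Fin d)} {r : ℝ} (hr : 0 ≤ r)
    (hv : ∀ i, ‖v i‖ ≤ r) : stackedNorm v ≤ Real.sqrt m * r := by
  rw [stackedNorm_eq]
  calc Real.sqrt (∑ i, ‖v i‖ ^ 2) ≤ Real.sqrt (∑ _i : Fin m, r ^ 2) :=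
        Real.sqrt_le_sqrt (Finset.sum_le_sum fun i _ => by gcongr; exact hv i)
    _ = Real.sqrt m * r := by
        simp [Real.sqrt_mul (Nat.cast_nonneg m), Real.sqrt_sq hr]

theorem sum_deviation (hm : 0 < m) (v : Fin m → EuclideanSpace ℝ (Fin d)) :
    ∑ i, deviation v i = 0 := by
  have hm' : (m : ℝ) ≠ 0 := by positivity
  simp only [deviation, Finset.sum_sub_distrib, Finset.sum_const, Finset.card_univ,
    Fintype.card_fin]
  rw [← Nat.cast_smul_eq_nsmul ℝ, smul_smul, mul_inv_cancel₀ hm', one_smul, sub_self]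

theorem deviation_smul_add_smul (a b : ℝ) (v w : Fin m → EuclideanSpace ℝ (Fin d)) :
    deviation (a • v + b • w) = a • deviation v + b • deviation w := by
  funext i
  simp only [deviation, Pi.add_apply, Pi.smul_apply, Finset.sum_add_distrib, ← Finset.smul_sum]
  module

theorem deviation_mix (hrow : ∀ i, ∑ j, W i j = 1) (hcol : ∀ j, ∑ i, W i j = 1)
    (v : Fin m → EuclideanSpace ℝ (Fin d)) : deviation (mix W v) = mix W (deviation v) := by
  have hsum : ∑ i, ∑ j, W i j • v j = ∑ j, v j := by
    rw [Finset.sum_comm]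
    simp [← Finset.sum_smul, hcol]
  funext i
  simp only [deviation, mix, hsum, smul_sub, Finset.sum_sub_distrib, ← Finset.sum_smul, hrow,
    one_smul]

theorem stackedNorm_mix_le {lam : ℝ} (hlam : 0 ≤ lam)
    (hW : ∀ y : Fin m → ℝ, ∑ i, y i = 0 →
      Real.sqrt (∑ i, (∑ j, W i j * y j) ^ 2) ≤ lam * Real.sqrt (∑ i, (y i) ^ 2))
    {v : Fin m → EuclideanSpace ℝ (Fin d)} (hv : ∑ i, v i = 0) :
    stackedNorm (mix W v) ≤ lam * stackedNorm v := by
  have hcoord (c : Fin d) :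
      ∑ i, (∑ j, W i j * v j c) ^ 2 ≤ lam ^ 2 * ∑ i, v i c ^ 2 := by
    have h0 : ∑ i, v i c = 0 := by
      simpa using congrArg (fun w : EuclideanSpace ℝ (Fin d) => w c) hv
    have h := pow_le_pow_left₀ (Real.sqrt_nonneg _) (hW (fun i => v i c) h0) 2
    rwa [mul_pow, Real.sq_sqrt (by positivity), Real.sq_sqrt (by positivity)] at h
  rw [stackedNorm_eq, stackedNorm_eq]
  refine Real.sqrt_le_iff.2 ⟨by positivity, ?_⟩
  rw [mul_pow, Real.sq_sqrt (by positivity)]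
  simp only [EuclideanSpace.norm_sq_eq, Real.norm_eq_abs, sq_abs]
  rw [Finset.sum_comm, Finset.sum_comm (s := Finset.univ (α := Fin m)), Finset.mul_sum]
  exact Finset.sum_le_sum fun c _ => by simpa [mix] using hcoord c

theorem stackedNorm_deviation_le (hm : 0 < m) {Ω : Set (EuclideanSpace ℝ (Fin d))}
    (hconv : Convex ℝ Ω) (hbdd : Bornology.IsBounded Ω)
    {v : Fin m → EuclideanSpace ℝ (Fin d)} (hv : ∀ i, v i ∈ Ω) :
    stackedNorm (deviation v) ≤ Real.sqrt m * Metric.diam Ω := by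
  have hm' : (m : ℝ) ≠ 0 := by positivity
  have hmean : (m : ℝ)⁻¹ • ∑ j, v j ∈ Ω := by
    rw [Finset.smul_sum]
    exact hconv.sum_mem (fun _ _ => by positivity) (by simp [hm']) fun i _ => hv i
  refine stackedNorm_le_sqrt_mul Metric.diam_nonneg fun i => ?_
  rw [deviation, ← dist_eq_norm]
  exact Metric.dist_le_diam_of_mem hbdd (hv i) hmean

end Network

section StepSize

variable {α : ℝ} {k : ℕ}

theorem rpow_neg_succ (hk : 1 ≤ k) :
    ((k + 1 : ℕ) : ℝ) ^ (-α) = (k : ℝ) ^ (-α) * ((k : ℝ) / ((k : ℝ) + 1)) ^ α := by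
  have hk' : (0 : ℝ) < k := by exact_mod_cast hk
  rw [Real.div_rpow hk'.le (by positivity), Real.rpow_neg hk'.le, Real.rpow_neg (by positivity)]
  have := Real.rpow_pos_of_pos hk' α
  push_cast
  field_simp

theorem rpow_neg_mul_le_rpow_neg_succ (hα : 0 ≤ α) {k₀ : ℕ} (hk₀ : 1 ≤ k₀) (hk : k₀ ≤ k) :
    (k : ℝ) ^ (-α) * ((k₀ : ℝ) / ((k₀ : ℝ) + 1)) ^ α ≤ ((k + 1 : ℕ) : ℝ) ^ (-α) := by
  rw [rpow_neg_succ (hk₀.trans hk)]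
  have hk' : (k₀ : ℝ) ≤ k := by exact_mod_cast hk
  have hdiv : (k₀ : ℝ) / ((k₀ : ℝ) + 1) ≤ (k : ℝ) / ((k : ℝ) + 1) := by
    rw [div_le_div_iff₀ (by positivity) (by positivity)]
    nlinarith
  gcongr

theorem rpow_neg_le_two_mul_succ (hα0 : 0 ≤ α) (hα1 : α ≤ 1) (hk : 1 ≤ k) :
    (k : ℝ) ^ (-α) ≤ 2 * ((k + 1 : ℕ) : ℝ) ^ (-α) := by
  have h := rpow_neg_mul_le_rpow_neg_succ hα0 le_rfl hk
  have hhalf : (1 / 2 : ℝ) ≤ ((1 : ℕ) / (((1 : ℕ) : ℝ) + 1) : ℝ) ^ α := by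
    norm_num
    simpa using Real.rpow_le_rpow_of_exponent_ge (x := 1 / 2) (by norm_num) (by norm_num) hα1
  have hpos : (0 : ℝ) ≤ (k : ℝ) ^ (-α) := by positivity
  nlinarith [mul_le_mul_of_nonneg_left hhalf hpos]

end StepSize

/-- Decay of the consensus error: `D` is the deviation of the iterates from their average and `z`
the deviation after one round of averaging. -/
theorem consensus_error_le {α lam M : ℝ} {k₀ : ℕ} {D z : ℕ → ℝ} (hα0 : 0 ≤ α) (hα1 : α ≤ 1)
    (hlam0 : 0 ≤ lam) (hlam1 : lam ≤ 1) (hk₀ : 1 ≤ k₀)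
    (hlam : lam ≤ ((k₀ : ℝ) / ((k₀ : ℝ) + 1)) ^ α * (1 + (k₀ : ℝ) ^ (-α))⁻¹)
    (hz0 : ∀ k, 0 ≤ z k) (hz : ∀ k, 1 ≤ k → z k ≤ lam * D k) (hD : ∀ k, 1 ≤ k → D k ≤ M)
    (hM : 0 ≤ M)
    (hstep : ∀ k : ℕ, 1 ≤ k →
      D (k + 1) ≤ (1 - (k : ℝ) ^ (-α)) * z k + (k : ℝ) ^ (-α) * M)
    {k : ℕ} (hk : 1 ≤ k) :
    z k ≤ (k₀ : ℝ) ^ α * M * (k : ℝ) ^ (-α) ∧ D k ≤ 4 * ((k₀ : ℝ) ^ α * M) * (k : ℝ) ^ (-α) := by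
  have hk₀' : (1 : ℝ) ≤ k₀ := by exact_mod_cast hk₀
  set C := (k₀ : ℝ) ^ α * M with hC
  have hpow : (1 : ℝ) ≤ (k₀ : ℝ) ^ α := Real.one_le_rpow hk₀' hα0
  have hMC : M = C * (k₀ : ℝ) ^ (-α) := by
    rw [hC, Real.rpow_neg (by positivity)]
    field_simp
  have hC0 : 0 ≤ C := by positivity
  have hMleC : M ≤ C := le_mul_of_one_le_left hM hpow
  have hnext : ∀ k : ℕ, 1 ≤ k → z k ≤ C * (k : ℝ) ^ (-α) →
      D (k + 1) ≤ (k : ℝ) ^ (-α) * (C + M) := fun k hk h => by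
    nlinarith [hstep k hk, mul_nonneg (by positivity : (0 : ℝ) ≤ (k : ℝ) ^ (-α)) (hz0 k)]
  have hzk : ∀ k : ℕ, 1 ≤ k → z k ≤ C * (k : ℝ) ^ (-α) := by
    intro k hk
    induction k, hk using Nat.le_induction with
    | base =>
      have h1 := hz 1 le_rfl
      have h2 := mul_le_mul_of_nonneg_left (hD 1 le_rfl) hlam0
      simp only [Nat.cast_one, Real.one_rpow, mul_one]
      nlinarith
    | succ k hk ih =>
      have hz' := hz (k + 1) (by omega)
      rcases le_or_gt k₀ k with hle | hlt
      · have hlam' : lam * (1 + (k₀ : ℝ) ^ (-α)) ≤ ((k₀ : ℝ) / ((k₀ : ℝ) + 1)) ^ α := by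
          rwa [← div_eq_mul_inv, le_div_iff₀ (by positivity)] at hlam
        calc z (k + 1) ≤ lam * ((k : ℝ) ^ (-α) * (C + M)) :=
              hz'.trans (mul_le_mul_of_nonneg_left (hnext k hk ih) hlam0)
          _ = C * ((k : ℝ) ^ (-α) * (lam * (1 + (k₀ : ℝ) ^ (-α)))) := by
              conv_lhs => rw [hMC]
              ring
          _ ≤ C * ((k : ℝ) ^ (-α) * ((k₀ : ℝ) / ((k₀ : ℝ) + 1)) ^ α) := by gcongr
          _ ≤ C * ((k + 1 : ℕ) : ℝ) ^ (-α) := by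
              gcongr
              exact rpow_neg_mul_le_rpow_neg_succ hα0 hk₀ hle
      · have hanti : (k₀ : ℝ) ^ (-α) ≤ ((k + 1 : ℕ) : ℝ) ^ (-α) :=
          Real.rpow_le_rpow_of_nonpos (by positivity) (by exact_mod_cast hlt) (by linarith)
        have h2 := mul_le_mul_of_nonneg_left (hD (k + 1) (by omega)) hlam0
        have h3 := mul_le_mul_of_nonneg_left hanti hC0
        nlinarith
  refine ⟨hzk k hk, ?_⟩
  obtain rfl | ⟨j, hj, rfl⟩ : k = 1 ∨ ∃ j, 1 ≤ j ∧ k = j + 1 := by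
    rcases Nat.lt_or_ge 1 k with h | h
    · exact Or.inr ⟨k - 1, by omega, by omega⟩
    · exact Or.inl (by omega)
  · simp only [Nat.cast_one, Real.one_rpow, mul_one]
    linarith [hD 1 le_rfl]
  · calc D (j + 1) ≤ (j : ℝ) ^ (-α) * (C + M) := hnext j hj (hzk j hj)
      _ ≤ (2 * ((j + 1 : ℕ) : ℝ) ^ (-α)) * (C + C) := by
          gcongr
          exact rpow_neg_le_two_mul_succ hα0 hα1 hj
      _ = 4 * C * ((j + 1 : ℕ) : ℝ) ^ (-α) := by ring

theorem iterate_increment_bound (d m : ℕ) (hm : 0 < m)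
    (Ω : Set (EuclideanSpace ℝ (Fin d))) (hne : Ω.Nonempty)
    (hconv : Convex ℝ Ω) (hcomp : IsCompact Ω)
    (ρ : ℝ) (hρ : ρ = Metric.diam Ω)
    (W : Matrix (Fin m) (Fin m) ℝ) (hWnn : ∀ i j, 0 ≤ W i j)
    (hrow : ∀ i, ∑ j, W i j = 1) (hcol : ∀ j, ∑ i, W i j = 1)
    (lam : ℝ) (hlam0 : 0 ≤ lam) (hlam1 : lam < 1)
    (hW : ∀ y : Fin m → ℝ, ∑ i, y i = 0 →
      Real.sqrt (∑ i, (∑ j, W i j * y j) ^ 2) ≤ lam * Real.sqrt (∑ i, (y i) ^ 2))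
    (α : ℝ) (hα0 : 0 < α) (hα1 : α ≤ 1)
    (γ : ℕ → ℝ) (hγ : ∀ k, γ k = (k : ℝ) ^ (-α))
    (k₀ : ℕ) (hk₀ : 1 ≤ k₀)
    (hk₀lam : lam ≤ ((k₀ : ℝ) / ((k₀ : ℝ) + 1)) ^ α * (1 + (k₀ : ℝ) ^ (-α))⁻¹)
    (Cp : ℝ) (hCp : Cp = (k₀ : ℝ) ^ α * Real.sqrt (m : ℝ) * ρ)
    (x u : Fin m → ℕ → EuclideanSpace ℝ (Fin d))
    (hx1 : ∀ i, x i 1 ∈ Ω) (hu : ∀ i k, 1 ≤ k → u i k ∈ Ω)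
    (hrec : ∀ i k, 1 ≤ k →
      x i (k + 1) = (1 - γ k) • (∑ j, W i j • x j k) + γ k • u i k) :
    ∀ i, ∀ k, 2 ≤ k →
      ‖x i k - x i (k - 1)‖ ≤ (5 * ρ + 7 * Cp) * γ (k - 1) := by
  subst hρ hCp
  obtain rfl : γ = fun k : ℕ => (k : ℝ) ^ (-α) := funext hγ
  have hbdd := hcomp.isBounded
  have hρ0 : 0 ≤ Metric.diam Ω := Metric.diam_nonneg
  have hγ0 (k : ℕ) : 0 ≤ (k : ℝ) ^ (-α) := by positivity
  have hγ1 (k : ℕ) (hk : 1 ≤ k) : (k : ℝ) ^ (-α) ≤ 1 :=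
    Real.rpow_le_one_of_one_le_of_nonpos (by exact_mod_cast hk) (by linarith)
  let X : ℕ → Fin m → EuclideanSpace ℝ (Fin d) := fun k i => x i k
  have hmix {v : Fin m → EuclideanSpace ℝ (Fin d)} (hv : ∀ i, v i ∈ Ω) (i : Fin m) :
      mix W v i ∈ Ω :=
    hconv.sum_mem (fun j _ => hWnn i j) (hrow i) fun j _ => hv j
  have hX (k : ℕ) (hk : 1 ≤ k) : ∀ i, X k i ∈ Ω := by
    induction k, hk using Nat.le_induction with
    | base => exact hx1
    | succ k hk ih =>
      intro i
      simp only [X, hrec i k hk]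
      exact hconv (hmix ih i) (hu i k hk) (sub_nonneg.2 (hγ1 k hk)) (hγ0 k) (by ring)
  have hdev (k : ℕ) (hk : 1 ≤ k) : deviation (X (k + 1)) =
      (1 - (k : ℝ) ^ (-α)) • mix W (deviation (X k)) +
        (k : ℝ) ^ (-α) • deviation (fun i => u i k) := by
    rw [← deviation_mix hrow hcol, ← deviation_smul_add_smul]
    exact congrArg deviation (funext fun i => hrec i k hk)
  intro i k hk
  obtain ⟨j, rfl⟩ : ∃ j, k = j + 1 := ⟨k - 1, by omega⟩
  have hj : 1 ≤ j := by omega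
  obtain ⟨hz, hD⟩ := consensus_error_le (M := Real.sqrt m * Metric.diam Ω)
    (D := fun k => stackedNorm (deviation (X k)))
    (z := fun k => stackedNorm (mix W (deviation (X k)))) hα0.le hα1 hlam0 hlam1.le hk₀ hk₀lam
    (fun k => stackedNorm_nonneg _)
    (fun k _ => stackedNorm_mix_le hlam0 hW (sum_deviation hm _))
    (fun k hk => stackedNorm_deviation_le hm hconv hbdd (hX k hk)) (by positivity)
    (fun k hk => by
      simp only [hdev k hk]
      refine (stackedNorm_smul_add_smul_le (sub_nonneg.2 (hγ1 k hk)) (hγ0 k) _ _).trans ?_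
      gcongr
      exact stackedNorm_deviation_le hm hconv hbdd fun i => hu i k hk) hj
  have hsplit : x i (j + 1) - x i j = mix W (deviation (X j)) i - deviation (X j) i +
      (j : ℝ) ^ (-α) • (u i j - mix W (X j) i) := by
    have hrec' : x i (j + 1) =
        (1 - (j : ℝ) ^ (-α)) • mix W (X j) i + (j : ℝ) ^ (-α) • u i j := hrec i j hj
    have hx : mix W (deviation (X j)) i = mix W (X j) i - (m : ℝ)⁻¹ • ∑ l, mix W (X j) l := by
      rw [← deviation_mix hrow hcol]; rfl
    have hsum : ∑ l, mix W (X j) l = ∑ l, X j l := by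
      simp only [mix]
      rw [Finset.sum_comm]
      simp [← Finset.sum_smul, hcol]
    rw [hrec', hx, hsum, deviation]
    simp only [X]
    module
  have hu' : ‖u i j - mix W (X j) i‖ ≤ Metric.diam Ω := by
    rw [← dist_eq_norm]
    exact Metric.dist_le_diam_of_mem hbdd (hu i j hj) (hmix (hX j hj) i)
  have hC0 : 0 ≤ (k₀ : ℝ) ^ α * (Real.sqrt m * Metric.diam Ω) := by positivity
  rw [Nat.add_sub_cancel, hsplit]
  calc _ ≤ ‖mix W (deviation (X j)) i‖ + ‖deviation (X j) i‖ +
        (j : ℝ) ^ (-α) * ‖u i j - mix W (X j) i‖ := by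
        refine (norm_add_le _ _).trans (add_le_add (norm_sub_le _ _) ?_)
        rw [norm_smul, Real.norm_of_nonneg (hγ0 j)]
    _ ≤ (k₀ : ℝ) ^ α * (Real.sqrt m * Metric.diam Ω) * (j : ℝ) ^ (-α) +
        4 * ((k₀ : ℝ) ^ α * (Real.sqrt m * Metric.diam Ω)) * (j : ℝ) ^ (-α) +
        (j : ℝ) ^ (-α) * Metric.diam Ω := by
        gcongr
        · exact (norm_le_stackedNorm _ i).trans hz
        · exact (norm_le_stackedNorm _ i).trans hD
    _ ≤ _ := by
        nlinarith [mul_nonneg (hγ0 j) hρ0, mul_nonneg (hγ0 j) hC0]
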